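/- arXiv:math-ph/0609006 — 7 statements merged into one kernel-verified Lean document; each statement's English description precedes it below -/
import Mathlib

section
/- Let ε > 0, let f be ε-convex on [0,1], and let 0 ≤ m1 < m2 ≤ 1. Let P be the ε-parabola joining (m1, f(m1)) and (m2, f(m2)), and define g(m) := P(m) for m1 ≤ m ≤ m2 and g(m) := f(m) for m ∈ [0,1] outside [m1,m2]. Then g is ε-convex on [0,1]. -/
open Set

noncomputable section

/-- A function `f` is `ε`-convex on `[0,1]` if `m ↦ f m - ε·m²/2` is convex on `[0,1]`. -/
def EpsConvexOn (ε : ℝ) (f : ℝ → ℝ) : Prop :=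
  ConvexOn ℝ (Set.Icc (0:ℝ) 1) (fun m => f m - ε * m ^ 2 / 2)

/-- The `ε`-convex hull of `f` on `[0,1]`:
`f_ε(m) = sup {φ(m) : φ is ε-convex on [0,1] and φ ≤ f on [0,1]}`. -/
def epsHull (ε : ℝ) (f : ℝ → ℝ) (m : ℝ) : ℝ :=
  sSup {y : ℝ | ∃ φ : ℝ → ℝ, EpsConvexOn ε φ ∧ (∀ s ∈ Set.Icc (0:ℝ) 1, φ s ≤ f s) ∧ y = φ m}

/-- The `ε`-parabola (quadratic with second derivative `ε`) joining `(m1, y1)` and `(m2, y2)`. -/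
def epsParabola (ε m1 m2 y1 y2 m : ℝ) : ℝ :=
  ((m2 - m) * y1 + (m - m1) * y2) / (m2 - m1) - ε / 2 * (m2 - m) * (m - m1)

/-- `m ∈ [0,1]` is a `Ψ`-cluster point (with parameter `ε`). -/
def IsClusterPoint (ε : ℝ) (Ψ : ℝ → ℝ) (m : ℝ) : Prop :=
  m ∈ Set.Icc (0:ℝ) 1 ∧ ∃ m1 m2 : ℝ, 0 ≤ m1 ∧ m1 < m ∧ m < m2 ∧ m2 ≤ 1 ∧
    ∀ s ∈ Set.Icc (0:ℝ) 1,
      s * Ψ m1 + (1 - s) * Ψ m2 + ε / 2 * s * (1 - s) * (m2 - m1) ^ 2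
        ≤ Ψ (s * m1 + (1 - s) * m2)

/-- The set `C_Ψ` of `Ψ`-cluster points. -/
def clusterSet (ε : ℝ) (Ψ : ℝ → ℝ) : Set ℝ := {m | IsClusterPoint ε Ψ m}

/-- `m ∈ [0,1]` is a `Ψ`-exposed point (with parameter `ε`). -/
def IsExposedPoint (ε : ℝ) (Ψ : ℝ → ℝ) (m : ℝ) : Prop :=
  m ∈ Set.Icc (0:ℝ) 1 ∧ ∀ m1 m2 : ℝ, 0 ≤ m1 → m1 < m → m < m2 → m2 ≤ 1 →
    Ψ m < epsParabola ε m1 m2 (Ψ m1) (Ψ m2) m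

/-- The set `E_Ψ` of `Ψ`-exposed points. -/
def exposedSet (ε : ℝ) (Ψ : ℝ → ℝ) : Set ℝ := {m | IsExposedPoint ε Ψ m}

/-- The closure `Ē_Ψ` in `[0,1]` of the set of `Ψ`-exposed points. -/
def exposedClosure (ε : ℝ) (Ψ : ℝ → ℝ) : Set ℝ :=
  closure (exposedSet ε Ψ) ∩ Set.Icc (0:ℝ) 1

/-- `(m1, m2)` is a maximal open interval contained in the cluster set `C_Ψ`. -/
def IsMaxClusterInterval (ε : ℝ) (Ψ : ℝ → ℝ) (m1 m2 : ℝ) : Prop :=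
  m1 < m2 ∧ Set.Ioo m1 m2 ⊆ clusterSet ε Ψ ∧
    ∀ a b : ℝ, Set.Ioo m1 m2 ⊆ Set.Ioo a b → Set.Ioo a b ⊆ clusterSet ε Ψ →
      Set.Ioo a b = Set.Ioo m1 m2

/-- `W = V_Φ`: `W` is continuous on `[0,1]`, coincides with `V` on `Ē_Φ`, and is affine on
every maximal open interval contained in `C_Φ`. -/
def IsVInterp (ε : ℝ) (Φ V W : ℝ → ℝ) : Prop :=
  ContinuousOn W (Set.Icc (0:ℝ) 1) ∧
  (∀ m ∈ exposedClosure ε Φ, W m = V m) ∧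
  ∀ m1 m2 : ℝ, IsMaxClusterInterval ε Φ m1 m2 →
    ∃ a b : ℝ, ∀ x ∈ Set.Ioo m1 m2, W x = a * x + b

/-- The affine function through `(a, h a)` and `(b, h b)`. -/
def chord (h : ℝ → ℝ) (a b x : ℝ) : ℝ :=
  ((b - x) * h a + (x - a) * h b) / (b - a)

theorem convexOn_chord (h : ℝ → ℝ) (a b : ℝ) {s : Set ℝ} (hs : Convex ℝ s) :
    ConvexOn ℝ s (chord h a b) := by
  refine ⟨hs, fun x _ y _ u v _ _ huv => le_of_eq ?_⟩
  obtain rfl : v = 1 - u := by linarith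
  simp only [chord, smul_eq_mul]
  ring

theorem ConvexOn.sub_mul_le {s : Set ℝ} {h : ℝ → ℝ} (hh : ConvexOn ℝ s h) {x y z : ℝ}
    (hx : x ∈ s) (hz : z ∈ s) (hxy : x ≤ y) (hyz : y ≤ z) :
    (z - x) * h y ≤ (z - y) * h x + (y - x) * h z := by
  rcases hxy.eq_or_lt with rfl | hxy
  · simp
  rcases hyz.eq_or_lt with rfl | hyz
  · simp
  have key := hh.slope_mono_adjacent hx hz hxy hyz
  rw [div_le_div_iff₀ (sub_pos.2 hxy) (sub_pos.2 hyz)] at key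
  linarith

theorem ConvexOn.le_chord {s : Set ℝ} {h : ℝ → ℝ} (hh : ConvexOn ℝ s h) {a b x : ℝ}
    (ha : a ∈ s) (hb : b ∈ s) (hab : a < b) (hx : x ∈ Set.Icc a b) :
    h x ≤ chord h a b x := by
  rw [chord, le_div_iff₀ (sub_pos.2 hab), mul_comm]
  exact hh.sub_mul_le ha hb hx.1 hx.2

theorem ConvexOn.chord_le {s : Set ℝ} {h : ℝ → ℝ} (hh : ConvexOn ℝ s h) {a b x : ℝ}
    (ha : a ∈ s) (hb : b ∈ s) (hxs : x ∈ s) (hab : a < b) (hx : x ∉ Set.Icc a b) :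
    chord h a b x ≤ h x := by
  rw [chord, div_le_iff₀ (sub_pos.2 hab)]
  rcases lt_or_ge x a with hxa | hax
  · linarith [hh.sub_mul_le hxs hb hxa.le hab.le]
  · have hbx : b < x := lt_of_not_ge fun hxb => hx ⟨hax, hxb⟩
    linarith [hh.sub_mul_le ha hxs hab.le hbx.le]

theorem epsParabola_sub_eq_chord (ε : ℝ) (f : ℝ → ℝ) {a b : ℝ} (hab : a < b) (m : ℝ) :
    epsParabola ε a b (f a) (f b) m - ε * m ^ 2 / 2 =
      chord (fun t => f t - ε * t ^ 2 / 2) a b m := by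
  have : b - a ≠ 0 := (sub_pos.2 hab).ne'
  simp only [epsParabola, chord]
  field_simp
  ring

theorem stmt_3 (ε : ℝ) (hε : 0 < ε) (f : ℝ → ℝ) (hf : EpsConvexOn ε f)
    (m1 m2 : ℝ) (h0 : 0 ≤ m1) (h12 : m1 < m2) (h1 : m2 ≤ 1)
    (g : ℝ → ℝ)
    (hg : g = fun m => if m ∈ Set.Icc m1 m2
      then epsParabola ε m1 m2 (f m1) (f m2) m else f m) :
    EpsConvexOn ε g := by
  have hf' : ConvexOn ℝ (Set.Icc (0:ℝ) 1) (fun m => f m - ε * m ^ 2 / 2) := hf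
  have hm1 : m1 ∈ Set.Icc (0:ℝ) 1 := ⟨h0, h12.le.trans h1⟩
  have hm2 : m2 ∈ Set.Icc (0:ℝ) 1 := ⟨h0.trans h12.le, h1⟩
  refine (hf'.sup (convexOn_chord (fun m => f m - ε * m ^ 2 / 2) m1 m2 hf'.1)).congr
    fun m hm => ?_
  subst hg
  by_cases hmem : m ∈ Set.Icc m1 m2
  · simp only [if_pos hmem, epsParabola_sub_eq_chord ε f h12]
    exact sup_eq_right.2 (hf'.le_chord hm1 hm2 h12 hmem)
  · simp only [if_neg hmem]
    exact sup_eq_left.2 (hf'.chord_le hm1 hm2 hm h12 hmem)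
end
end

section
/- Let ε > 0 and let f : [0,1] → ℝ be continuous and convex on [0,1]. Suppose there is a countable set S ⊂ [0,1] such that at every point m ∈ [0,1] \ S the function f is twice differentiable with f''(m) ≥ ε. Then f is ε-convex on [0,1]. -/
open Set

noncomputable section

/-- A monotone function whose derivative is a.e. at least `c` grows at rate at least `c`. -/
theorem mul_sub_le_sub_of_monotoneOn_of_ae_le_deriv {g : ℝ → ℝ} {a b c : ℝ} (hab : a ≤ b)
    (hg : MonotoneOn g (Icc a b))
    (hc : ∀ᵐ x ∂MeasureTheory.volume, x ∈ Icc a b → c ≤ deriv g x) :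
    c * (b - a) ≤ g b - g a := by
  have hg' : MonotoneOn g (uIcc a b) := by rwa [uIcc_of_le hab]
  have hgab : g a ≤ g b := hg (left_mem_Icc.2 hab) (right_mem_Icc.2 hab) hab
  have hmem := hg'.intervalIntegral_deriv_mem_uIcc
  rw [uIcc_of_le (sub_nonneg.2 hgab)] at hmem
  have hle : ∫ _ in a..b, c ≤ ∫ x in a..b, deriv g x := by
    refine intervalIntegral.integral_mono_ae_restrict hab intervalIntegrable_const
      hg'.intervalIntegrable_deriv ?_
    exact (MeasureTheory.ae_restrict_iff' measurableSet_Icc).2 hc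
  rw [intervalIntegral.integral_const, smul_eq_mul] at hle
  linarith [hmem.2]

/-- A function with a monotone right derivative on an open interval is convex there. -/
theorem convexOn_Ioo_of_hasDerivWithinAt_Ioi {f g : ℝ → ℝ} {a b : ℝ}
    (hf : ContinuousOn f (Ioo a b)) (hd : ∀ x ∈ Ioo a b, HasDerivWithinAt f (g x) (Ioi x) x)
    (hg : MonotoneOn g (Ioo a b)) : ConvexOn ℝ (Ioo a b) f := by
  refine convexOn_of_slope_mono_adjacent (convex_Ioo a b) fun {x y z} hx hz hxy hyz => ?_
  have hy : y ∈ Ioo a b := ⟨hx.1.trans hxy, hyz.trans hz.2⟩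
  have hsub : ∀ {u v}, u ∈ Ioo a b → v ∈ Ioo a b → Icc u v ⊆ Ioo a b :=
    fun hu hv => ordConnected_Ioo.out hu hv
  have hlin : ∀ (k p q u : ℝ) (s : Set ℝ),
      HasDerivWithinAt (fun t => q + k * (t - p)) k s u := fun k p q u s => by
    simpa using ((((hasDerivAt_id u).sub_const p).const_mul k).const_add q).hasDerivWithinAt
  have hleft : f y ≤ f x + g y * (y - x) :=
    image_le_of_deriv_right_le_deriv_boundary (B := fun t => f x + g y * (t - x))
      (B' := fun _ => g y) (hf.mono (hsub hx hy))
      (fun t ht => (hd t (hsub hx hy ⟨ht.1, ht.2.le⟩)).Ici_of_Ioi)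
      (by simp) (by fun_prop) (fun t _ => hlin _ _ _ _ _)
      (fun t ht => hg (hsub hx hy ⟨ht.1, ht.2.le⟩) hy ht.2.le) (right_mem_Icc.2 hxy.le)
  have hright : f y + g y * (z - y) ≤ f z :=
    image_le_of_deriv_right_le_deriv_boundary (f := fun t => f y + g y * (t - y))
      (f' := fun _ => g y) (by fun_prop) (fun t _ => hlin _ _ _ _ _)
      (by simp) (hf.mono (hsub hy hz))
      (fun t ht => (hd t (hsub hy hz ⟨ht.1, ht.2.le⟩)).Ici_of_Ioi)
      (fun t ht => hg hy (hsub hy hz ⟨ht.1, ht.2.le⟩) ht.1) (right_mem_Icc.2 hyz.le)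
  calc (f y - f x) / (y - x) ≤ g y := by
        rw [div_le_iff₀ (sub_pos.2 hxy)]; linarith
    _ ≤ (f z - f y) / (z - y) := by
        rw [le_div_iff₀ (sub_pos.2 hyz)]; linarith

/-- Convexity extends by continuity from an open interval to its closure. -/
theorem ConvexOn.Icc_of_Ioo {f : ℝ → ℝ} {a b : ℝ} (hab : a < b)
    (hf : ContinuousOn f (Icc a b)) (hconv : ConvexOn ℝ (Ioo a b) f) :
    ConvexOn ℝ (Icc a b) f := by
  refine ⟨convex_Icc a b, fun x hx y hy s t hs ht hst => ?_⟩
  have hsub : Ioo a b ×ˢ Ioo a b ⊆ Icc a b ×ˢ Icc a b :=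
    prod_mono Ioo_subset_Icc_self Ioo_subset_Icc_self
  have hcl : (x, y) ∈ closure (Ioo a b ×ˢ Ioo a b) := by
    rw [closure_prod_eq, closure_Ioo hab.ne]
    exact ⟨hx, hy⟩
  have hl : ContinuousOn (fun p : ℝ × ℝ => f (s • p.1 + t • p.2)) (Icc a b ×ˢ Icc a b) :=
    hf.comp (by fun_prop) fun p hp => convex_Icc a b hp.1 hp.2 hs ht hst
  have hr : ContinuousOn (fun p : ℝ × ℝ => s • f p.1 + t • f p.2) (Icc a b ×ˢ Icc a b) :=
    ((hf.comp continuousOn_fst fun p hp => hp.1).const_smul s).add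
      ((hf.comp continuousOn_snd fun p hp => hp.2).const_smul t)
  exact ContinuousWithinAt.closure_le hcl ((hl _ ⟨hx, hy⟩).mono hsub)
    ((hr _ ⟨hx, hy⟩).mono hsub) fun p hp => hconv.2 hp.1 hp.2 hs ht hst

/-- Where `deriv f` has a nonzero derivative, the right derivative of `f` has the same one. -/
theorem deriv_derivWithin_Ioi_eq {f : ℝ → ℝ} {x : ℝ} (hf : DifferentiableAt ℝ f x)
    (hx : deriv (deriv f) x ≠ 0) :
    deriv (fun y => derivWithin f (Ioi y) y) x = deriv (deriv f) x := by
  have hne := (differentiableAt_of_deriv_ne_zero hx).hasDerivAt.eventually_ne (c := 0) hx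
  refine Filter.EventuallyEq.deriv_eq ?_
  filter_upwards [eventually_nhdsWithin_iff.1 hne] with y hy
  have hfy : DifferentiableAt ℝ f y := by
    by_cases hyx : y = x
    · rwa [hyx]
    · exact differentiableAt_of_deriv_ne_zero (hy hyx)
  exact hfy.derivWithin (uniqueDiffWithinAt_Ioi y)

theorem stmt_4 (ε : ℝ) (hε : 0 < ε) (f : ℝ → ℝ)
    (hfc : ContinuousOn f (Set.Icc (0:ℝ) 1))
    (hconv : ConvexOn ℝ (Set.Icc (0:ℝ) 1) f)
    (S : Set ℝ) (hS : S.Countable) (hSsub : S ⊆ Set.Icc (0:ℝ) 1)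
    (hdiff : ∀ m ∈ Set.Icc (0:ℝ) 1 \ S,
      DifferentiableAt ℝ f m ∧ DifferentiableAt ℝ (deriv f) m ∧ ε ≤ deriv (deriv f) m) :
    EpsConvexOn ε f := by
  have hint : ∀ x ∈ Ioo (0:ℝ) 1, x ∈ interior (Icc (0:ℝ) 1) := fun x hx => by
    rwa [interior_Icc]
  have hcont : ContinuousOn (fun m => f m - ε * m ^ 2 / 2) (Icc (0:ℝ) 1) :=
    hfc.sub (by fun_prop)
  refine ConvexOn.Icc_of_Ioo zero_lt_one hcont ?_
  refine convexOn_Ioo_of_hasDerivWithinAt_Ioi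
    (g := fun x => derivWithin f (Ioi x) x - ε * x) (hcont.mono Ioo_subset_Icc_self) ?_ ?_
  · intro x hx
    refine (hconv.hasDerivWithinAt_rightDeriv_of_mem_interior (hint x hx)).sub ?_
    have h := (((hasDerivAt_pow 2 x).const_mul ε).div_const 2).hasDerivWithinAt (s := Ioi x)
    exact h.congr_deriv (by ring)
  · intro x hx y hy hxy
    have hmono := hconv.monotoneOn_rightDeriv
    rw [interior_Icc] at hmono
    have hsub : Icc x y ⊆ Ioo 0 1 := ordConnected_Ioo.out hx hy
    have hgrow := mul_sub_le_sub_of_monotoneOn_of_ae_le_deriv (c := ε) hxy (hmono.mono hsub) (by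
      filter_upwards [hS.ae_notMem MeasureTheory.volume] with m hm hmem
      obtain ⟨h₁, -, h₃⟩ := hdiff m ⟨Ioo_subset_Icc_self (hsub hmem), hm⟩
      rwa [deriv_derivWithin_Ioi_eq h₁ (hε.trans_le h₃).ne'])
    dsimp only
    linarith
end
end

section
/- Let ε > 0, let Ψ be continuous on [0,1], and let Ψ_ε be its ε-convex hull. If Ψ_ε(m) < Ψ(m) for all m in some open interval (m1,m2) ⊆ [0,1], then Ψ_ε coincides on (m1,m2) with a quadratic function whose second derivative is identically ε (an ε-parabola). -/
open Set

noncomputable section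

lemma le_epsHull {ε : ℝ} {f φ : ℝ → ℝ} (hφ : EpsConvexOn ε φ)
    (hle : ∀ s ∈ Set.Icc (0:ℝ) 1, φ s ≤ f s) {m : ℝ} (hm : m ∈ Set.Icc (0:ℝ) 1) :
    φ m ≤ epsHull ε f m := by
  refine le_csSup ⟨f m, ?_⟩ ⟨φ, hφ, hle, rfl⟩
  rintro y ⟨ψ, -, hψ, rfl⟩
  exact hψ m hm

lemma exists_epsConvexOn_le (ε : ℝ) {f : ℝ → ℝ} (hf : ContinuousOn f (Set.Icc (0:ℝ) 1)) :
    ∃ φ : ℝ → ℝ, EpsConvexOn ε φ ∧ ∀ s ∈ Set.Icc (0:ℝ) 1, φ s ≤ f s := by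
  have hc : ContinuousOn (fun m => f m - ε * m ^ 2 / 2) (Set.Icc (0:ℝ) 1) := by fun_prop
  obtain ⟨c, hc⟩ := isCompact_Icc.bddBelow_image hc
  refine ⟨fun m => c + ε * m ^ 2 / 2, ?_, fun s hs => ?_⟩
  · simpa [EpsConvexOn] using convexOn_const c (convex_Icc (0:ℝ) 1)
  · have := hc (mem_image_of_mem _ hs)
    linarith

lemma epsHull_le {ε : ℝ} {f : ℝ → ℝ} {m y : ℝ} (hf : ContinuousOn f (Set.Icc (0:ℝ) 1))
    (h : ∀ φ : ℝ → ℝ, EpsConvexOn ε φ → (∀ s ∈ Set.Icc (0:ℝ) 1, φ s ≤ f s) → φ m ≤ y) :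
    epsHull ε f m ≤ y := by
  obtain ⟨φ, hφ, hle⟩ := exists_epsConvexOn_le ε hf
  refine csSup_le ⟨φ m, φ, hφ, hle, rfl⟩ ?_
  rintro _ ⟨ψ, hψ, hψle, rfl⟩
  exact h ψ hψ hψle

lemma epsHull_le_self {ε : ℝ} {f : ℝ → ℝ} {m : ℝ} (hf : ContinuousOn f (Set.Icc (0:ℝ) 1))
    (hm : m ∈ Set.Icc (0:ℝ) 1) : epsHull ε f m ≤ f m :=
  epsHull_le hf fun _ _ hle => hle m hm

lemma epsConvexOn_epsHull (ε : ℝ) {f : ℝ → ℝ} (hf : ContinuousOn f (Set.Icc (0:ℝ) 1)) :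
    EpsConvexOn ε (epsHull ε f) := by
  refine ⟨convex_Icc 0 1, fun x hx y hy a b ha hb hab => ?_⟩
  have key : epsHull ε f (a • x + b • y) ≤
      a • (epsHull ε f x - ε * x ^ 2 / 2) + b • (epsHull ε f y - ε * y ^ 2 / 2)
        + ε * (a • x + b • y) ^ 2 / 2 := by
    refine epsHull_le hf fun φ hφ hle => ?_
    have h := hφ.2 hx hy ha hb hab
    have h1 := mul_le_mul_of_nonneg_left (le_epsHull hφ hle hx) ha
    have h2 := mul_le_mul_of_nonneg_left (le_epsHull hφ hle hy) hb
    simp only [smul_eq_mul] at h ⊢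
    linarith
  simp only at key ⊢
  linarith

/-- A convex function that is maximal among the convex functions below `F` is affine on every
compact interval on which it stays strictly below `F`. -/
lemma eq_affine_of_maximal_convex {s : Set ℝ} {g F : ℝ → ℝ} (hg : ConvexOn ℝ s g)
    (hle : ∀ x ∈ s, g x ≤ F x)
    (hmax : ∀ h : ℝ → ℝ, ConvexOn ℝ s h → (∀ x ∈ s, h x ≤ F x) → ∀ x ∈ s, h x ≤ g x)
    {a b : ℝ} (hab : a < b) (hs : Set.Icc a b ⊆ s) (hgc : ContinuousOn g (Set.Icc a b))
    (hFc : ContinuousOn F (Set.Icc a b)) (hlt : ∀ x ∈ Set.Icc a b, g x < F x) :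
    ∃ p q : ℝ, ∀ x ∈ Set.Icc a b, g x = p * x + q := by
  have ha : a ∈ s := hs (left_mem_Icc.2 hab.le)
  have hb : b ∈ s := hs (right_mem_Icc.2 hab.le)
  obtain ⟨p, q, hpa, hpb⟩ : ∃ p q : ℝ, g a = p * a + q ∧ g b = p * b + q := by
    have : b - a ≠ 0 := (sub_pos.2 hab).ne'
    refine ⟨(g b - g a) / (b - a), g a - (g b - g a) / (b - a) * a, by ring, ?_⟩
    field_simp
    ring
  have hL : ConvexOn ℝ s (fun x => p * x + q) := by
    refine ⟨hg.1, fun x _ y _ c d _ _ hcd => ?_⟩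
    simp only [smul_eq_mul]
    exact le_of_eq (by linear_combination -q * hcd)
  have hout : ∀ x ∈ s, x ∉ Set.Icc a b → p * x + q ≤ g x := by
    intro x hx hxab
    rcases lt_or_ge x a with hxa | hxa
    · have := hg.slope_mono_adjacent hx hb hxa hab
      rw [div_le_div_iff₀ (by linarith) (by linarith), hpa, hpb] at this
      nlinarith
    · have hbx : b < x := lt_of_not_ge fun h => hxab ⟨hxa, h⟩
      have := hg.slope_mono_adjacent ha hx hab hbx
      rw [div_le_div_iff₀ (by linarith) (by linarith), hpa, hpb] at this
      nlinarith
  have hin : ∀ x ∈ Set.Icc a b, g x ≤ p * x + q := by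
    intro x hx
    have hpos : 0 < b - a := sub_pos.2 hab
    have := hg.2 ha hb (show 0 ≤ (b - x) / (b - a) from
      div_nonneg (by linarith [hx.2]) hpos.le) (show 0 ≤ (x - a) / (b - a) from
      div_nonneg (by linarith [hx.1]) hpos.le)
      (by field_simp; ring)
    simp only [smul_eq_mul, hpa, hpb] at this
    have h1 : (b - x) / (b - a) * a + (x - a) / (b - a) * b = x := by field_simp; ring
    have h2 : (b - x) / (b - a) * (p * a + q) + (x - a) / (b - a) * (p * b + q) = p * x + q := by
      field_simp; ring
    rwa [h1, h2] at this
  obtain ⟨x₀, hx₀, hmin⟩ := isCompact_Icc.exists_isMinOn (nonempty_Icc.2 hab.le) (hFc.sub hgc)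
  obtain ⟨M, hM⟩ := isCompact_Icc.bddAbove_image
    (f := fun x => p * x + q - g x) (K := Set.Icc a b) (by fun_prop)
  obtain ⟨δ, hδ, hδle⟩ : ∃ δ > 0, ∀ x ∈ Set.Icc a b, δ ≤ F x - g x :=
    ⟨F x₀ - g x₀, sub_pos.2 (hlt x₀ hx₀), fun x hx => hmin hx⟩
  have hMle : ∀ x ∈ Set.Icc a b, p * x + q - g x ≤ M := fun x hx => hM (mem_image_of_mem _ hx)
  have hM0 : 0 ≤ M := by
    have := hMle a (left_mem_Icc.2 hab.le)
    linarith
  obtain ⟨t, ht0, ht1, htM⟩ : ∃ t : ℝ, 0 < t ∧ t ≤ 1 ∧ t * M ≤ δ := by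
    refine ⟨δ / (δ + M), by positivity, ?_, ?_⟩
    · rw [div_le_one (by positivity)]; linarith
    · rw [div_mul_eq_mul_div, div_le_iff₀ (by positivity)]
      nlinarith
  have hconv : ConvexOn ℝ s (fun x => (1 - t) * g x + t * max (g x) (p * x + q)) :=
    (hg.smul (sub_nonneg.2 ht1)).add ((hg.sup hL).smul ht0.le)
  have hbelow : ∀ x ∈ s, (1 - t) * g x + t * max (g x) (p * x + q) ≤ F x := by
    intro x hx
    by_cases hxab : x ∈ Set.Icc a b
    · rw [max_eq_right (hin x hxab)]
      have := mul_le_mul_of_nonneg_left (hMle x hxab) ht0.le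
      linarith [hδle x hxab]
    · rw [max_eq_left (hout x hx hxab)]
      linarith [hle x hx]
  refine ⟨p, q, fun x hx => le_antisymm (hin x hx) ?_⟩
  have := hmax _ hconv hbelow x (hs hx)
  rw [max_eq_right (hin x hx)] at this
  exact le_of_mul_le_mul_left (by linarith) ht0

/-- A function that is affine on every compact subinterval of an open interval is affine there. -/
lemma eq_affine_Ioo_of_Icc {g : ℝ → ℝ} {m1 m2 : ℝ} (h12 : m1 < m2)
    (h : ∀ a b : ℝ, m1 < a → a < b → b < m2 → ∃ p q : ℝ, ∀ x ∈ Set.Icc a b, g x = p * x + q) :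
    ∃ p q : ℝ, ∀ x ∈ Set.Ioo m1 m2, g x = p * x + q := by
  obtain ⟨c, hc1, hc2⟩ := exists_between h12
  obtain ⟨d, hcd, hd2⟩ := exists_between hc2
  obtain ⟨p, q, hpq⟩ := h c d hc1 hcd hd2
  refine ⟨p, q, fun x hx => ?_⟩
  obtain ⟨p', q', hpq'⟩ := h (min c x) (max d x) (lt_min hc1 hx.1)
    ((min_le_left _ _).trans_lt (hcd.trans_le (le_max_left _ _))) (max_lt hd2 hx.2)
  have hc := hpq c (left_mem_Icc.2 hcd.le)
  have hd := hpq d (right_mem_Icc.2 hcd.le)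
  rw [hpq' c ⟨min_le_left _ _, hcd.le.trans (le_max_left _ _)⟩] at hc
  rw [hpq' d ⟨(min_le_left _ _).trans hcd.le, le_max_left _ _⟩] at hd
  have hp : p' = p :=
    mul_right_cancel₀ (sub_pos.2 hcd).ne' (by linear_combination hd - hc)
  subst hp
  rw [hpq' x ⟨min_le_right _ _, le_max_right _ _⟩]
  linarith

theorem stmt_8 (ε : ℝ) (hε : 0 < ε) (Ψ : ℝ → ℝ)
    (hΨc : ContinuousOn Ψ (Set.Icc (0:ℝ) 1))
    (m1 m2 : ℝ) (h12 : m1 < m2) (hsub : Set.Ioo m1 m2 ⊆ Set.Icc (0:ℝ) 1)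
    (hlt : ∀ m ∈ Set.Ioo m1 m2, epsHull ε Ψ m < Ψ m) :
    ∃ a b : ℝ, ∀ m ∈ Set.Ioo m1 m2,
      epsHull ε Ψ m = ε / 2 * m ^ 2 + a * m + b := by
  have hopen : Set.Ioo m1 m2 ⊆ interior (Set.Icc (0:ℝ) 1) :=
    interior_maximal hsub isOpen_Ioo
  have hconv := epsConvexOn_epsHull ε hΨc
  obtain ⟨p, q, hpq⟩ := eq_affine_Ioo_of_Icc (g := fun m => epsHull ε Ψ m - ε * m ^ 2 / 2) h12 <| by
    intro a b ha hab hb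
    have hIoo : Set.Icc a b ⊆ Set.Ioo m1 m2 := Icc_subset_Ioo ha hb
    refine eq_affine_of_maximal_convex (F := fun m => Ψ m - ε * m ^ 2 / 2) hconv ?_ ?_ hab
      (hIoo.trans hsub) (hconv.continuousOn_interior.mono (hIoo.trans hopen)) ?_ ?_
    · intro x hx
      have := epsHull_le_self (ε := ε) hΨc hx
      linarith
    · intro h hh hle x hx
      have hφ : EpsConvexOn ε (fun m => h m + ε * m ^ 2 / 2) := by
        simpa [EpsConvexOn] using hh
      have := le_epsHull hφ (f := Ψ) (fun s hs => by linarith [hle s hs]) hx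
      linarith
    · have := hΨc.mono (hIoo.trans hsub)
      fun_prop
    · intro x hx
      have := hlt x (hIoo hx)
      linarith
  refine ⟨p, q, fun m hm => ?_⟩
  have := hpq m hm
  linarith
end
end

section
/- Let ε > 0, let Ψ be continuous on [0,1], and let Ψ_ε be its ε-convex hull. If m belongs to the closure Ē_Ψ in [0,1] of the set of Ψ-exposed points, then Ψ_ε(m) = Ψ(m). -/
open Set

noncomputable section

/-- The strict parabola inequality at exposed points passes to a weak one on the closure. -/
lemma le_epsParabola_of_mem_closure {ε : ℝ} {Ψ : ℝ → ℝ}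
    (hΨc : ContinuousOn Ψ (Set.Icc (0:ℝ) 1)) {m m1 m2 : ℝ}
    (hm : m ∈ closure (exposedSet ε Ψ)) (h0 : 0 ≤ m1) (h1 : m1 < m) (h2 : m < m2)
    (h3 : m2 ≤ 1) : Ψ m ≤ epsParabola ε m1 m2 (Ψ m1) (Ψ m2) m := by
  have hmem : m ∈ closure (Set.Ioo m1 m2 ∩ exposedSet ε Ψ) :=
    isOpen_Ioo.inter_closure ⟨⟨h1, h2⟩, hm⟩
  have hsub : Set.Ioo m1 m2 ∩ exposedSet ε Ψ ⊆ Set.Icc (0:ℝ) 1 := fun x hx => hx.2.1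
  have hP : Continuous (epsParabola ε m1 m2 (Ψ m1) (Ψ m2)) := by
    unfold epsParabola
    fun_prop
  exact ContinuousWithinAt.closure_le hmem
    ((hΨc m ⟨by linarith, by linarith⟩).mono hsub) hP.continuousWithinAt
    fun y hy => (hy.2.2 m1 m2 h0 hy.1.1 hy.1.2 h3).le

/-- A function lying below all its chords around an interior point has a supporting line there. -/
lemma exists_supporting_slope {g : ℝ → ℝ} {a b m : ℝ} (ha : a < m) (hb : m < b)
    (hg : ∀ x y, a ≤ x → x < m → m < y → y ≤ b →
      (y - x) * g m ≤ (y - m) * g x + (m - x) * g y) :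
    ∃ k : ℝ, ∀ x ∈ Set.Icc a b, g m + k * (x - m) ≤ g x := by
  obtain ⟨k, hkl, hkr⟩ := exists_between_of_forall_le
    (s := (fun x => (g m - g x) / (m - x)) '' Set.Ico a m)
    (t := (fun y => (g y - g m) / (y - m)) '' Set.Ioc m b)
    (Set.Nonempty.image _ ⟨a, le_rfl, ha⟩) (Set.Nonempty.image _ ⟨b, hb, le_rfl⟩) (by
      rintro _ ⟨x, hx, rfl⟩ _ ⟨y, hy, rfl⟩
      have := hg x y hx.1 hx.2 hy.1 hy.2
      rw [div_le_div_iff₀ (sub_pos.2 hx.2) (sub_pos.2 hy.1)]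
      linarith)
  refine ⟨k, fun x hx => ?_⟩
  rcases lt_trichotomy x m with h | rfl | h
  · have := hkl (Set.mem_image_of_mem _ ⟨hx.1, h⟩)
    rw [div_le_iff₀ (sub_pos.2 h)] at this
    linarith
  · simp
  · have := hkr (Set.mem_image_of_mem _ ⟨h, hx.2⟩)
    rw [le_div_iff₀ (sub_pos.2 h)] at this
    linarith

/-- Raising a constant function at an extreme point of a convex set keeps it convex. -/
lemma convexOn_update_const {s : Set ℝ} {m c d : ℝ} (hm : m ∈ s.extremePoints ℝ)
    (hs : Convex ℝ s) (hcd : c ≤ d) :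
    ConvexOn ℝ s (Function.update (fun _ => c) m d) := by
  refine convexOn_iff_pairwise_pos.2 ⟨hs, fun x hx y hy hxy a b ha hb hab => ?_⟩
  have hne : a • x + b • y ≠ m := fun h => by
    obtain ⟨hxm, hym⟩ := (mem_extremePoints.1 hm).2 x hx y hy ⟨a, b, ha, hb, hab, h⟩
    exact hxy (hxm.trans hym.symm)
  have hle : ∀ z, c ≤ Function.update (fun _ => c) m d z := fun z => by
    by_cases hz : z = m
    · subst hz
      simpa using hcd
    · simp [hz]
  rw [Function.update_of_ne hne]
  calc c = a • c + b • c := by rw [← add_smul, hab, one_smul]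
    _ ≤ _ := by
      simp only [smul_eq_mul]
      exact add_le_add (mul_le_mul_of_nonneg_left (hle x) ha.le)
        (mul_le_mul_of_nonneg_left (hle y) hb.le)

/-- A convex minorant of `Ψ - ε·x²/2` touching it at `m` makes the `ε`-convex hull touch `Ψ`. -/
lemma epsHull_eq_of_convex_minorant {ε : ℝ} {Ψ h : ℝ → ℝ} {m : ℝ} (hm : m ∈ Set.Icc (0:ℝ) 1)
    (hconv : ConvexOn ℝ (Set.Icc (0:ℝ) 1) h)
    (hle : ∀ x ∈ Set.Icc (0:ℝ) 1, h x ≤ Ψ x - ε * x ^ 2 / 2)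
    (heq : h m = Ψ m - ε * m ^ 2 / 2) : epsHull ε Ψ m = Ψ m := by
  refine IsGreatest.csSup_eq ⟨⟨fun x => h x + ε * x ^ 2 / 2, ?_, fun s hs => ?_, ?_⟩, ?_⟩
  · simpa [EpsConvexOn] using hconv
  · linarith [hle s hs]
  · linarith
  · rintro _ ⟨φ, -, hφ, rfl⟩
    exact hφ m hm

theorem stmt_11 (ε : ℝ) (hε : 0 < ε) (Ψ : ℝ → ℝ)
    (hΨc : ContinuousOn Ψ (Set.Icc (0:ℝ) 1))
    (m : ℝ) (hm : m ∈ exposedClosure ε Ψ) :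
    epsHull ε Ψ m = Ψ m := by
  obtain ⟨hcl, hI⟩ := hm
  by_cases hint : 0 < m ∧ m < 1
  · obtain ⟨k, hk⟩ := exists_supporting_slope (g := fun x => Ψ x - ε * x ^ 2 / 2)
      hint.1 hint.2 (by
        intro x y h0 h1 h2 h3
        have h := le_epsParabola_of_mem_closure hΨc hcl h0 h1 h2 h3
        have hpos : 0 < y - x := by linarith
        rw [epsParabola, le_sub_iff_add_le, le_div_iff₀ hpos] at h
        linarith)
    refine epsHull_eq_of_convex_minorant hI
      (h := fun x => (Ψ m - ε * m ^ 2 / 2) + k * (x - m)) ⟨convex_Icc _ _, ?_⟩ hk (by simp)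
    intro x _ y _ a b _ _ hab
    obtain rfl : b = 1 - a := by linarith
    simp only [smul_eq_mul]
    apply le_of_eq
    ring
  · have hgc : ContinuousOn (fun x => Ψ x - ε * x ^ 2 / 2) (Set.Icc (0:ℝ) 1) :=
      hΨc.sub (by fun_prop)
    obtain ⟨c, hc⟩ := isCompact_Icc.bddBelow_image hgc
    have hc' : ∀ x ∈ Set.Icc (0:ℝ) 1, c ≤ Ψ x - ε * x ^ 2 / 2 :=
      fun x hx => hc (Set.mem_image_of_mem _ hx)
    have hext : m ∈ (Set.Icc (0:ℝ) 1).extremePoints ℝ := by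
      rw [extremePoints_Icc zero_le_one]
      by_contra hne
      simp only [Set.mem_insert_iff, Set.mem_singleton_iff, not_or] at hne
      exact hint ⟨lt_of_le_of_ne hI.1 (Ne.symm hne.1), lt_of_le_of_ne hI.2 hne.2⟩
    refine epsHull_eq_of_convex_minorant hI
      (convexOn_update_const hext (convex_Icc _ _) (hc' m hI)) (fun x hx => ?_) (by simp)
    by_cases hxm : x = m
    · subst hxm
      simp
    · simpa [hxm] using hc' x hx
end
end

section
/- Let ε > 0 and let Ψ1, Ψ2 be continuous on [0,1]. If the sets of exposed points coincide, E_{Ψ1} = E_{Ψ2}, and Ψ1(m) = Ψ2(m) for every m ∈ E_{Ψ1}, then the ε-convex hulls coincide everywhere: (Ψ1)_ε(m) = (Ψ2)_ε(m) for all m ∈ [0,1]. (The ε-convex hull Ψ_ε is determined everywhere by the values of Ψ on E_Ψ.) -/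
open Set

noncomputable section

/-- The chord inequality for a convex function, with denominators cleared. -/
theorem ConvexOn.sub_mul_le_chord {s : Set ℝ} {f : ℝ → ℝ} (hf : ConvexOn ℝ s f) {a x b : ℝ}
    (ha : a ∈ s) (hb : b ∈ s) (hax : a ≤ x) (hxb : x ≤ b) :
    (b - a) * f x ≤ (b - x) * f a + (x - a) * f b := by
  rcases (hax.trans hxb).eq_or_lt with rfl | hab
  · obtain rfl := le_antisymm hax hxb
    simp
  have hpos : 0 < b - a := sub_pos.2 hab
  have h := hf.2 ha hb (div_nonneg (sub_nonneg.2 hxb) hpos.le)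
    (div_nonneg (sub_nonneg.2 hax) hpos.le) (by field_simp; ring)
  simp only [smul_eq_mul] at h
  have hx : (b - x) / (b - a) * a + (x - a) / (b - a) * b = x := by field_simp; ring
  rw [hx] at h
  calc (b - a) * f x ≤ (b - a) * ((b - x) / (b - a) * f a + (x - a) / (b - a) * f b) :=
        mul_le_mul_of_nonneg_left h hpos.le
    _ = (b - x) * f a + (x - a) * f b := by field_simp

/-- A convex function on a compact interval grows at most linearly away from each point. -/
theorem ConvexOn.exists_le_add_mul_abs_sub {a b : ℝ} {f : ℝ → ℝ}
    (hf : ConvexOn ℝ (Icc a b) f) {x : ℝ} (hx : x ∈ Icc a b) :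
    ∃ K : ℝ, ∀ y ∈ Icc a b, f y ≤ f x + K * |y - x| := by
  have hab : a ≤ b := hx.1.trans hx.2
  refine ⟨|f a - f x| / (x - a) + |f b - f x| / (b - x), fun y hy => ?_⟩
  have hA : 0 ≤ |f a - f x| / (x - a) := div_nonneg (abs_nonneg _) (sub_nonneg.2 hx.1)
  have hB : 0 ≤ |f b - f x| / (b - x) := div_nonneg (abs_nonneg _) (sub_nonneg.2 hx.2)
  rcases lt_trichotomy y x with hlt | rfl | hgt
  · have hpos : 0 < x - a := sub_pos.2 (hy.1.trans_lt hlt)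
    have h := hf.sub_mul_le_chord (left_mem_Icc.2 hab) hx hy.1 hlt.le
    have hmul : (x - a) * (|f a - f x| / (x - a)) = |f a - f x| := by field_simp
    have hle := mul_le_mul_of_nonneg_left (le_abs_self (f a - f x)) (sub_nonneg.2 hlt.le)
    have hkey : f y ≤ f x + |f a - f x| / (x - a) * (x - y) := by
      refine le_of_mul_le_mul_left ?_ hpos
      linear_combination h + hle - (x - y) * hmul
    rw [abs_of_neg (sub_neg.2 hlt)]
    linear_combination hkey + mul_nonneg hB (sub_nonneg.2 hlt.le)
  · simp
  · have hpos : 0 < b - x := sub_pos.2 (hgt.trans_le hy.2)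
    have h := hf.sub_mul_le_chord hx (right_mem_Icc.2 hab) hgt.le hy.2
    have hmul : (b - x) * (|f b - f x| / (b - x)) = |f b - f x| := by field_simp
    have hle := mul_le_mul_of_nonneg_left (le_abs_self (f b - f x)) (sub_nonneg.2 hgt.le)
    have hkey : f y ≤ f x + |f b - f x| / (b - x) * (y - x) := by
      refine le_of_mul_le_mul_left ?_ hpos
      linear_combination h + hle - (y - x) * hmul
    rw [abs_of_pos (sub_pos.2 hgt)]
    linear_combination hkey + mul_nonneg hA (sub_nonneg.2 hgt.le)

/-- A convex function on a compact interval is upper semicontinuous, endpoints included. -/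
theorem ConvexOn.upperSemicontinuousOn_Icc {a b : ℝ} {f : ℝ → ℝ}
    (hf : ConvexOn ℝ (Icc a b) f) : UpperSemicontinuousOn f (Icc a b) := by
  intro x hx y hy
  obtain ⟨K, hK⟩ := hf.exists_le_add_mul_abs_sub hx
  have hcont : ContinuousWithinAt (fun z => f x + K * |z - x|) (Icc a b) x := by fun_prop
  have hy' : f x + K * |x - x| < y := by simpa using hy
  filter_upwards [hcont.eventually_lt_const hy', self_mem_nhdsWithin] with z hz hmem
  exact (hK z hmem).trans_lt hz

/-- If `f` is convex and lies strictly above the continuous function `g` somewhere on `[a,b]`,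
it does so at a point where `g` lies strictly below all of its chords. -/
theorem ConvexOn.exists_lt_of_lt {a b : ℝ} {f g : ℝ → ℝ} (hf : ConvexOn ℝ (Icc a b) f)
    (hg : ContinuousOn g (Icc a b)) {x : ℝ} (hx : x ∈ Icc a b) (hlt : g x < f x) :
    ∃ m ∈ Icc a b, g m < f m ∧ ∀ m1 m2 : ℝ, a ≤ m1 → m1 < m → m < m2 → m2 ≤ b →
      (m2 - m1) * g m < (m2 - m) * g m1 + (m - m1) * g m2 := by
  have hd : UpperSemicontinuousOn (fun z => f z - g z) (Icc a b) := by
    have h := hf.upperSemicontinuousOn_Icc.add hg.neg.upperSemicontinuousOn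
    simpa [sub_eq_add_neg] using h
  obtain ⟨p, hp, hmax⟩ := hd.exists_isMaxOn ⟨x, hx⟩ isCompact_Icc
  rw [isMaxOn_iff] at hmax
  obtain ⟨m, hm, hlast⟩ :=
    (hd.isCompact_inter_preimage_Ici isCompact_Icc (f p - g p)).exists_isGreatest ⟨p, hp, le_refl (f p - g p)⟩
  have hmp : f p - g p ≤ f m - g m := hm.2
  refine ⟨m, hm.1, by linarith [hmax x hx], fun m1 m2 h1 h1m hm2 h2 => ?_⟩
  have hm1 : m1 ∈ Icc a b := ⟨h1, h1m.le.trans hm.1.2⟩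
  have hm2' : m2 ∈ Icc a b := ⟨hm.1.1.trans hm2.le, h2⟩
  have hstrict : f m2 - g m2 < f p - g p := by
    by_contra! hge
    exact hm2.not_ge (hlast ⟨hm2', hge⟩)
  have hchord := hf.sub_mul_le_chord hm1 hm2' h1m.le hm2.le
  have e1 := mul_le_mul_of_nonneg_left (hmax m1 hm1) (sub_nonneg.2 hm2.le)
  have e2 := mul_lt_mul_of_pos_left hstrict (sub_pos.2 h1m)
  have e3 := mul_le_mul_of_nonneg_left hmp (sub_nonneg.2 (h1m.trans hm2).le)
  linear_combination hchord + e1 + e2 + e3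

theorem lt_epsParabola_iff {ε m1 m2 y1 y2 m y : ℝ} (h : m1 < m2) :
    y < epsParabola ε m1 m2 y1 y2 m ↔
      (m2 - m1) * (y - ε * m ^ 2 / 2) <
        (m2 - m) * (y1 - ε * m1 ^ 2 / 2) + (m - m1) * (y2 - ε * m2 ^ 2 / 2) := by
  have hpos : 0 < m2 - m1 := sub_pos.2 h
  rw [epsParabola, lt_sub_iff_add_lt, lt_div_iff₀ hpos, ← sub_pos, ← sub_pos (b := (m2 - m1) * _)]
  ring_nf

/-- An `ε`-convex function lies below a continuous `Ψ` on `[0,1]` as soon as it does so on the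
exposed points of `Ψ`. -/
theorem EpsConvexOn.le_of_le_exposedSet {ε : ℝ} {φ Ψ : ℝ → ℝ} (hφ : EpsConvexOn ε φ)
    (hΨ : ContinuousOn Ψ (Icc (0:ℝ) 1)) (hle : ∀ m ∈ exposedSet ε Ψ, φ m ≤ Ψ m) :
    ∀ s ∈ Icc (0:ℝ) 1, φ s ≤ Ψ s := by
  intro s hs
  by_contra! hlt
  have hg : ContinuousOn (fun m => Ψ m - ε * m ^ 2 / 2) (Icc (0:ℝ) 1) := by fun_prop
  obtain ⟨m, hm, hgt, hexp⟩ := ConvexOn.exists_lt_of_lt hφ hg hs (sub_lt_sub_right hlt _)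
  have hmem : m ∈ exposedSet ε Ψ := ⟨hm, fun m1 m2 h1 h1m hm2 h2 =>
    (lt_epsParabola_iff (h1m.trans hm2)).2 (hexp m1 m2 h1 h1m hm2 h2)⟩
  have := hle m hmem
  linarith

theorem stmt_12 (ε : ℝ) (hε : 0 < ε) (Ψ1 Ψ2 : ℝ → ℝ)
    (h1c : ContinuousOn Ψ1 (Set.Icc (0:ℝ) 1))
    (h2c : ContinuousOn Ψ2 (Set.Icc (0:ℝ) 1))
    (hE : exposedSet ε Ψ1 = exposedSet ε Ψ2)
    (hval : ∀ m ∈ exposedSet ε Ψ1, Ψ1 m = Ψ2 m) :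
    ∀ m ∈ Set.Icc (0:ℝ) 1, epsHull ε Ψ1 m = epsHull ε Ψ2 m := by
  have hiff : ∀ φ : ℝ → ℝ, EpsConvexOn ε φ →
      ((∀ s ∈ Set.Icc (0:ℝ) 1, φ s ≤ Ψ1 s) ↔ ∀ s ∈ Set.Icc (0:ℝ) 1, φ s ≤ Ψ2 s) :=
    fun φ hφ =>
      ⟨fun h => hφ.le_of_le_exposedSet h2c fun m hm => by
          rw [← hE] at hm
          exact (h m hm.1).trans_eq (hval m hm),
        fun h => hφ.le_of_le_exposedSet h1c fun m hm =>
          (h m hm.1).trans_eq (hval m hm).symm⟩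
  intro m _
  unfold epsHull
  congr 1
  ext y
  exact exists_congr fun φ => and_congr_right fun hφ => and_congr_left fun _ => hiff φ hφ
end
end

section
/- Let ε > 0 and let Ψ be continuous on [0,1]. If (m1,m2) is a maximal open interval contained in the cluster set C_Ψ (i.e., (m1,m2) ⊆ C_Ψ and no strictly larger interval contained in C_Ψ contains it), then for every s ∈ [0,1]: Ψ(s·m1 + (1−s)·m2) ≥ s·Ψ(m1) + (1−s)·Ψ(m2) + (ε/2)·s·(1−s)·(m2−m1)². -/
open Set

noncomputable section

/-- A continuous function on `[p, q]`, nonnegative at the endpoints, such that every interior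
point `x` lies in some `(a, b) ⊆ (p, q)` at which the value is at least that of the chord over
`[a, b]`, is nonnegative on `[p, q]`. -/
theorem nonneg_of_local_chord_le {h : ℝ → ℝ} {p q : ℝ}
    (hc : ContinuousOn h (Icc p q)) (hp : 0 ≤ h p) (hq : 0 ≤ h q)
    (hx : ∀ x ∈ Ioo p q, ∃ a b : ℝ, p ≤ a ∧ a < x ∧ x < b ∧ b ≤ q ∧
      (b - x) * h a + (x - a) * h b ≤ (b - a) * h x) :
    ∀ x ∈ Icc p q, 0 ≤ h x := by
  intro z hz
  obtain ⟨y, hy, hmin⟩ := isCompact_Icc.exists_isMinOn ⟨z, hz⟩ hc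
  have hmin' : ∀ t ∈ Icc p q, h y ≤ h t := fun t ht => hmin ht
  refine le_trans ?_ (hmin' z hz)
  by_contra! hneg
  have hclosed : IsClosed (Icc p q ∩ h ⁻¹' {h y}) :=
    hc.preimage_isClosed_of_isClosed isClosed_Icc isClosed_singleton
  obtain ⟨x, ⟨hxI, hxy⟩, hleast⟩ :=
    (isCompact_Icc.of_isClosed_subset hclosed inter_subset_left).exists_isLeast ⟨y, hy, rfl⟩
  have hxy' : h x = h y := hxy
  have hpx : p < x := lt_of_le_of_ne hxI.1 (by rintro rfl; linarith)
  have hxq : x < q := lt_of_le_of_ne hxI.2 (by rintro rfl; linarith)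
  obtain ⟨a, b, hpa, hax, hxb, hbq, hchord⟩ := hx x ⟨hpx, hxq⟩
  have haI : a ∈ Icc p q := ⟨hpa, by linarith⟩
  have hb : h y ≤ h b := hmin' b ⟨by linarith, hbq⟩
  have ha : h a ≤ h y := by
    by_contra! hlt
    nlinarith [mul_pos (sub_pos.2 hxb) (sub_pos.2 hlt),
      mul_nonneg (sub_pos.2 hax).le (sub_nonneg.2 hb)]
  exact absurd (hleast ⟨haI, le_antisymm ha (hmin' a haI)⟩) (not_le.2 hax)

/-- Every point of a maximal open interval of cluster points is a cluster point by virtue of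
endpoints lying in the closure of that interval. -/
theorem IsMaxClusterInterval.exists_endpoints {ε : ℝ} {Ψ : ℝ → ℝ} {m1 m2 x : ℝ}
    (hmax : IsMaxClusterInterval ε Ψ m1 m2) (hx : x ∈ Ioo m1 m2) :
    ∃ a b : ℝ, m1 ≤ a ∧ a < x ∧ x < b ∧ b ≤ m2 ∧ ∀ s ∈ Icc (0:ℝ) 1,
      s * Ψ a + (1 - s) * Ψ b + ε / 2 * s * (1 - s) * (b - a) ^ 2
        ≤ Ψ (s * a + (1 - s) * b) := by
  obtain ⟨hlt, hsub, hM⟩ := hmax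
  obtain ⟨-, a, b, ha0, hax, hxb, hb1, hab⟩ := hsub hx
  have key : Ioo (min a m1) (max b m2) ⊆ clusterSet ε Ψ := by
    intro t ht
    have ht' : t ∈ Ioo a b ∨ t ∈ Ioo m1 m2 := by
      obtain ⟨hl, hr⟩ := ht
      rw [min_lt_iff] at hl
      rw [lt_max_iff] at hr
      have hx1 := hx.1
      have hx2 := hx.2
      simp only [mem_Ioo]
      grind
    rcases ht' with ht' | ht'
    · exact ⟨⟨ha0.trans ht'.1.le, ht'.2.le.trans hb1⟩, a, b, ha0, ht'.1, ht'.2, hb1, hab⟩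
    · exact hsub ht'
  have heq := hM _ _ (Ioo_subset_Ioo (min_le_right a m1) (le_max_right b m2)) key
  have hne : min a m1 < max b m2 := (min_le_right a m1).trans_lt (hlt.trans_le (le_max_right b m2))
  obtain ⟨h1, h2⟩ := (Ioo_subset_Ioo_iff hne).1 heq.subset
  exact ⟨a, b, h1.trans (min_le_left a m1), hax, hxb, (le_max_left b m2).trans h2, hab⟩

theorem stmt_13 (ε : ℝ) (hε : 0 < ε) (Ψ : ℝ → ℝ)
    (hΨc : ContinuousOn Ψ (Set.Icc (0:ℝ) 1))
    (m1 m2 : ℝ) (hmax : IsMaxClusterInterval ε Ψ m1 m2) :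
    ∀ s ∈ Set.Icc (0:ℝ) 1,
      s * Ψ m1 + (1 - s) * Ψ m2 + ε / 2 * s * (1 - s) * (m2 - m1) ^ 2
        ≤ Ψ (s * m1 + (1 - s) * m2) := by
  obtain ⟨hlt, hsub, -⟩ := id hmax
  have hI : Icc m1 m2 ⊆ Icc (0:ℝ) 1 := by
    rw [← closure_Ioo hlt.ne]
    exact closure_minimal (fun x hx => (hsub hx).1) isClosed_Icc
  have hpos : ∀ x ∈ Icc m1 m2, 0 ≤ (m2 - m1) * (Ψ x + ε / 2 * x ^ 2)
      - (m2 - x) * (Ψ m1 + ε / 2 * m1 ^ 2) - (x - m1) * (Ψ m2 + ε / 2 * m2 ^ 2) := by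
    apply nonneg_of_local_chord_le
    · have := hΨc.mono hI
      fun_prop
    · apply le_of_eq; ring
    · apply le_of_eq; ring
    · intro x hx
      obtain ⟨a, b, h1, hax, hxb, h2, hab⟩ := hmax.exists_endpoints hx
      refine ⟨a, b, h1, hax, hxb, h2, ?_⟩
      have hba : 0 < b - a := by linarith
      have hs := hab ((b - x) / (b - a))
        ⟨div_nonneg (by linarith) hba.le, (div_le_one hba).2 (by linarith)⟩
      have h1s : 1 - (b - x) / (b - a) = (x - a) / (b - a) := by field_simp; ring
      have hpt : (b - x) / (b - a) * a + (x - a) / (b - a) * b = x := by field_simp; ring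
      rw [h1s, hpt] at hs
      have hs' : (b - x) * Ψ a + (x - a) * Ψ b + ε / 2 * (b - x) * (x - a) * (b - a)
          ≤ (b - a) * Ψ x := by
        refine le_trans (le_of_eq ?_) (mul_le_mul_of_nonneg_left hs hba.le)
        field_simp
      linear_combination (m2 - m1) * hs'
  intro s hs
  have hd : 0 < m2 - m1 := sub_pos.2 hlt
  have hx := hpos (s * m1 + (1 - s) * m2)
    ⟨by nlinarith [mul_nonneg (sub_nonneg.2 hs.2) hd.le], by nlinarith [mul_nonneg hs.1 hd.le]⟩
  refine le_of_mul_le_mul_left ?_ hd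
  linear_combination hx
end
end

section
/- Let ε > 0 and let Ψ be continuous on [0,1]. A point m ∈ [0,1] is a Ψ-exposed point if and only if the exposedness inequality Ψ(m) < ((m2−m)·Ψ(m1) + (m−m1)·Ψ(m2))/(m2−m1) − (ε/2)·(m2−m)·(m−m1) holds for all 0 ≤ m1 < m < m2 ≤ 1 with m1 ∈ Ē_Ψ and m2 ∈ Ē_Ψ. -/
open Set

noncomputable section

/-- The value at `m` of the chord of `g` joining the points over `a` and `b`. -/
def chordValue (g : ℝ → ℝ) (a b m : ℝ) : ℝ :=
  ((b - m) * g a + (m - a) * g b) / (b - a)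

lemma lt_epsParabola_iff_lt_chordValue (ε : ℝ) (Ψ : ℝ → ℝ) {a b m : ℝ} (hab : a < b) :
    Ψ m < epsParabola ε a b (Ψ a) (Ψ b) m ↔
      Ψ m - ε * m ^ 2 / 2 < chordValue (fun x => Ψ x - ε * x ^ 2 / 2) a b m := by
  have hne : b - a ≠ 0 := (sub_pos.2 hab).ne'
  have key : epsParabola ε a b (Ψ a) (Ψ b) m - Ψ m =
      chordValue (fun x => Ψ x - ε * x ^ 2 / 2) a b m - (Ψ m - ε * m ^ 2 / 2) := by
    unfold epsParabola chordValue
    field_simp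
    ring
  rw [← sub_pos, key, sub_pos]

/-- If some chord of a continuous function lies weakly below the graph at `m`, then among the
chords spanning `m` there is one which is lowest at `m`. -/
lemma exists_chordValue_le {g : ℝ → ℝ} (hg : ContinuousOn g (Icc 0 1)) {m p q : ℝ}
    (hp : 0 ≤ p) (hpm : p < m) (hmq : m < q) (hq : q ≤ 1) (hpq : chordValue g p q m ≤ g m) :
    ∃ a b : ℝ, 0 ≤ a ∧ a < m ∧ m < b ∧ b ≤ 1 ∧ chordValue g a b m ≤ g m ∧
      ∀ x y : ℝ, 0 ≤ x → x < m → m < y → y ≤ 1 → chordValue g a b m ≤ chordValue g x y m := by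
  let S : Set (ℝ × ℝ × ℝ) :=
    (Icc 0 m ×ˢ Icc m 1 ×ˢ Icc 0 1) ∩ {z | z.2.2 * z.1 + (1 - z.2.2) * z.2.1 = m}
  have hS : IsCompact S :=
    (isCompact_Icc.prod (isCompact_Icc.prod isCompact_Icc)).inter_right
      (isClosed_eq (by fun_prop) (by fun_prop))
  have hmem : ∀ x y : ℝ, 0 ≤ x → x < m → m < y → y ≤ 1 → (x, y, (y - m) / (y - x)) ∈ S := by
    intro x y hx hxm hmy hy
    have hxy : 0 < y - x := by linarith
    refine ⟨⟨⟨hx, hxm.le⟩, ⟨hmy.le, hy⟩, ⟨div_nonneg (by linarith) hxy.le, ?_⟩⟩, ?_⟩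
    · rw [div_le_one hxy]
      linarith
    · change (y - m) / (y - x) * x + (1 - (y - m) / (y - x)) * y = m
      field_simp
      ring
  have hval : ∀ x y t : ℝ, x < m → m < y → t * x + (1 - t) * y = m →
      t * g x + (1 - t) * g y = chordValue g x y m := by
    intro x y t hx hy ht
    have hxy : y - x ≠ 0 := by linarith
    rw [chordValue, eq_div_iff hxy, ← ht]
    ring
  have hG : ContinuousOn
      (fun z : ℝ × ℝ × ℝ => z.2.2 * g z.1 + (1 - z.2.2) * g z.2.1) S := by
    have h₁ : ContinuousOn (fun z : ℝ × ℝ × ℝ => g z.1) S :=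
      hg.comp continuous_fst.continuousOn
        fun z hz => ⟨hz.1.1.1, by linarith [hz.1.1.2]⟩
    have h₂ : ContinuousOn (fun z : ℝ × ℝ × ℝ => g z.2.1) S :=
      hg.comp (by fun_prop) fun z hz => ⟨by linarith [hz.1.2.1.1], hz.1.2.1.2⟩
    have ht : ContinuousOn (fun z : ℝ × ℝ × ℝ => z.2.2) S := by fun_prop
    exact (ht.mul h₁).add ((continuousOn_const.sub ht).mul h₂)
  obtain ⟨⟨a, b, t⟩, ⟨⟨⟨ha, ham⟩, ⟨hmb, hb⟩, -⟩, ht⟩, hmin⟩ :=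
    hS.exists_isMinOn ⟨_, hmem p q hp hpm hmq hq⟩ hG
  change 0 ≤ a at ha
  change a ≤ m at ham
  change m ≤ b at hmb
  change b ≤ 1 at hb
  change t * a + (1 - t) * b = m at ht
  have hle : ∀ x y : ℝ, 0 ≤ x → x < m → m < y → y ≤ 1 →
      t * g a + (1 - t) * g b ≤ chordValue g x y m := by
    intro x y hx hxm hmy hy
    have hz := hmem x y hx hxm hmy hy
    rw [← hval x y _ hxm hmy hz.2]
    exact hmin hz
  rcases (hle p q hp hpm hmq hq).eq_or_lt with heq | hlt
  · exact ⟨p, q, hp, hpm, hmq, hq, hpq, heq ▸ hle⟩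
  · have hlt' := hlt.trans_le hpq
    have ham' : a < m := by
      refine ham.lt_of_ne fun h => hlt'.ne ?_
      subst h
      have : (1 - t) * (b - a) = 0 := by linear_combination ht
      rcases mul_eq_zero.1 this with h | h
      · rw [h, show t = 1 by linarith]
        ring
      · rw [show b = a by linarith]
        ring
    have hmb' : m < b := by
      refine hmb.lt_of_ne fun h => hlt'.ne ?_
      subst h
      have : t * (m - a) = 0 := by linear_combination -ht
      rcases mul_eq_zero.1 this with h | h
      · rw [h]
        ring
      · linarith
    rw [hval a b t ham' hmb' ht] at hle hlt'
    exact ⟨a, b, ha, ham', hmb', hb, hlt'.le, hle⟩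

/-- If some chord of a continuous function lies weakly below the graph at `m`, then so does a
chord whose endpoints are the extreme contact points of the graph with a supporting line. -/
lemma exists_supporting_chord {g : ℝ → ℝ} (hg : ContinuousOn g (Icc 0 1)) {m p q : ℝ}
    (hp : 0 ≤ p) (hpm : p < m) (hmq : m < q) (hq : q ≤ 1) (hpq : chordValue g p q m ≤ g m) :
    ∃ a b c d : ℝ, 0 ≤ a ∧ a < m ∧ m < b ∧ b ≤ 1 ∧ c * m + d ≤ g m ∧
      g a = c * a + d ∧ g b = c * b + d ∧ (∀ x ∈ Icc (0 : ℝ) 1, c * x + d ≤ g x) ∧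
      (∀ x, 0 ≤ x → x < a → c * x + d < g x) ∧ ∀ x, b < x → x ≤ 1 → c * x + d < g x := by
  obtain ⟨a, b, ha, ham, hmb, hb, hab, hmin⟩ := exists_chordValue_le hg hp hpm hmq hq hpq
  have hba : 0 < b - a := by linarith
  obtain ⟨c, hc⟩ : ∃ c, c * (b - a) = g b - g a := ⟨_, div_mul_cancel₀ _ hba.ne'⟩
  obtain ⟨d, hd⟩ : ∃ d, g a = c * a + d := ⟨g a - c * a, by ring⟩
  have hd' : g b = c * b + d := by linear_combination hd - hc
  have hchord : chordValue g a b m = c * m + d := by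
    rw [chordValue, div_eq_iff hba.ne', hd, hd']
    ring
  rw [hchord] at hab hmin
  have hsupp : ∀ x ∈ Icc (0 : ℝ) 1, c * x + d ≤ g x := by
    rintro x ⟨hx₀, hx₁⟩
    rcases lt_trichotomy x m with hx | rfl | hx
    · have h := hmin x b hx₀ hx hmb hb
      rw [chordValue, le_div_iff₀ (by linarith), hd'] at h
      exact le_of_mul_le_mul_left (by linarith) (sub_pos.2 hmb)
    · exact hab
    · have h := hmin a x ha ham hx hx₁
      rw [chordValue, le_div_iff₀ (by linarith), hd] at h
      exact le_of_mul_le_mul_left (by linarith) (sub_pos.2 ham)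
  let K : Set ℝ := Icc 0 1 ∩ (fun x => g x - (c * x + d)) ⁻¹' {0}
  have hcont : ContinuousOn (fun x => g x - (c * x + d)) (Icc 0 1) := by fun_prop
  have hK : IsCompact K :=
    isCompact_Icc.of_isClosed_subset
      (hcont.preimage_isClosed_of_isClosed isClosed_Icc isClosed_singleton) inter_subset_left
  have haK : a ∈ K := ⟨⟨ha, by linarith⟩, sub_eq_zero.2 hd⟩
  have hbK : b ∈ K := ⟨⟨by linarith, hb⟩, sub_eq_zero.2 hd'⟩
  obtain ⟨a', ha'K, ha'⟩ := hK.exists_isLeast ⟨a, haK⟩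
  obtain ⟨b', hb'K, hb'⟩ := hK.exists_isGreatest ⟨a, haK⟩
  refine ⟨a', b', c, d, ha'K.1.1, (ha' haK).trans_lt ham, hmb.trans_le (hb' hbK), hb'K.1.2, hab,
    sub_eq_zero.1 ha'K.2, sub_eq_zero.1 hb'K.2, hsupp, fun x hx hxa => ?_, fun x hbx hx => ?_⟩
  · have hxI : x ∈ Icc (0 : ℝ) 1 := ⟨hx, hxa.le.trans ha'K.1.2⟩
    exact (hsupp x hxI).lt_of_ne fun h => hxa.not_ge (ha' ⟨hxI, sub_eq_zero.2 h.symm⟩)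
  · have hxI : x ∈ Icc (0 : ℝ) 1 := ⟨hb'K.1.1.trans hbx.le, hx⟩
    exact (hsupp x hxI).lt_of_ne fun h => hbx.not_ge (hb' ⟨hxI, sub_eq_zero.2 h.symm⟩)

theorem stmt_14 (ε : ℝ) (hε : 0 < ε) (Ψ : ℝ → ℝ)
    (hΨc : ContinuousOn Ψ (Set.Icc (0:ℝ) 1))
    (m : ℝ) (hm : m ∈ Set.Icc (0:ℝ) 1) :
    IsExposedPoint ε Ψ m ↔
      ∀ m1 m2 : ℝ, 0 ≤ m1 → m1 < m → m < m2 → m2 ≤ 1 →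
        m1 ∈ exposedClosure ε Ψ → m2 ∈ exposedClosure ε Ψ →
          Ψ m < epsParabola ε m1 m2 (Ψ m1) (Ψ m2) m := by
  refine ⟨fun h m1 m2 h₀ h₁ h₂ h₃ _ _ => h.2 m1 m2 h₀ h₁ h₂ h₃, fun h => ⟨hm, ?_⟩⟩
  by_contra! ⟨p, q, hp, hpm, hmq, hq, hpq⟩
  have hg : ContinuousOn (fun x => Ψ x - ε * x ^ 2 / 2) (Icc 0 1) := by fun_prop
  rw [← not_lt, lt_epsParabola_iff_lt_chordValue ε Ψ (hpm.trans hmq), not_lt] at hpq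
  obtain ⟨a, b, c, d, ha, ham, hmb, hb, hcm, hca, hcb, hsupp, hlt_a, hlt_b⟩ :=
    exists_supporting_chord hg hp hpm hmq hq hpq
  have hexp_a : IsExposedPoint ε Ψ a := by
    refine ⟨⟨ha, by linarith⟩, fun x y hx hxa hay hy => ?_⟩
    rw [lt_epsParabola_iff_lt_chordValue ε Ψ (hxa.trans hay), chordValue,
      lt_div_iff₀ (by linarith), hca]
    have h₁ := mul_lt_mul_of_pos_left (hlt_a x hx hxa) (sub_pos.2 hay)
    have h₂ := mul_le_mul_of_nonneg_left (hsupp y ⟨by linarith, hy⟩) (sub_pos.2 hxa).le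
    linarith
  have hexp_b : IsExposedPoint ε Ψ b := by
    refine ⟨⟨by linarith, hb⟩, fun x y hx hxb hby hy => ?_⟩
    rw [lt_epsParabola_iff_lt_chordValue ε Ψ (hxb.trans hby), chordValue,
      lt_div_iff₀ (by linarith), hcb]
    have h₁ := mul_le_mul_of_nonneg_left (hsupp x ⟨hx, by linarith⟩) (sub_pos.2 hby).le
    have h₂ := mul_lt_mul_of_pos_left (hlt_b y hby hy) (sub_pos.2 hxb)
    linarith
  have hlt := h a b ha ham hmb hb ⟨subset_closure hexp_a, hexp_a.1⟩
    ⟨subset_closure hexp_b, hexp_b.1⟩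
  rw [lt_epsParabola_iff_lt_chordValue ε Ψ (ham.trans hmb), chordValue,
    lt_div_iff₀ (by linarith), hca, hcb] at hlt
  have := mul_le_mul_of_nonneg_right hcm (sub_pos.2 (ham.trans hmb)).le
  linarith
end
end
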